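/- arXiv:1403.1426 — 3 statements merged into one kernel-verified Lean document; each statement's English description precedes it below -/
import Mathlib

section
/- Let E = {(P, l) ∈ ℙ² × T_C : P ∈ C ∩ l} be the incidence set over the transversal lines, with pr : E → T_C the projection (P, l) ↦ l, where E carries the subspace topology. Then pr is a topological covering map and every fiber pr⁻¹(l), l ∈ T_C, has exactly d elements. -/
open MvPolynomial

noncomputable section

/-- The complex projective plane `ℙ²(ℂ)` (also used as its own dual `ℙ̂²`). -/
abbrev P2 : Type := Projectivization ℂ (Fin 3 → ℂ)

/-- The classical (Euclidean) topology on `ℙ²(ℂ)`: the quotient topology from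
`ℂ³ \ {0}`. -/
instance : TopologicalSpace P2 :=
  inferInstanceAs (TopologicalSpace (Quotient (projectivizationSetoid ℂ (Fin 3 → ℂ))))

/-- The line in `ℙ²` corresponding to a point `ξ` of the dual plane `ℙ̂²`:
the zero locus of the linear form with coefficient vector `ξ`. -/
def lineSet (ξ : P2) : Set P2 := {x | ∑ i, ξ.rep i * x.rep i = 0}

/-- The plane curve `{F = 0} ⊂ ℙ²` defined by a homogeneous polynomial `F`. -/
def curveSet (F : MvPolynomial (Fin 3) ℂ) : Set P2 := {x | eval x.rep F = 0}

/-- `T_C`: the set of (points of `ℙ̂²` corresponding to) lines meeting the degree `d`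
curve `C = {F = 0}` transversally, i.e. in exactly `d` distinct points. -/
def transversalLines (F : MvPolynomial (Fin 3) ℂ) (d : ℕ) : Set P2 :=
  {ξ | (curveSet F ∩ lineSet ξ).ncard = d}

/-- The incidence set `E = {(P, l) ∈ ℙ² × T_C : P ∈ C ∩ l}`, with the subspace topology
from `ℙ² × ℙ̂²`. -/
abbrev incidenceSet (F : MvPolynomial (Fin 3) ℂ) (d : ℕ) : Type :=
  {pl : P2 × P2 // pl.2 ∈ transversalLines F d ∧ pl.1 ∈ curveSet F ∩ lineSet pl.2}

/-- The projection `pr : E → T_C`, `(P, l) ↦ l`. -/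
def incidenceProj (F : MvPolynomial (Fin 3) ℂ) (d : ℕ) :
    incidenceSet F d → transversalLines F d :=
  fun e => ⟨e.val.2, e.prop.1⟩

open Topology Filter

theorem IsOpenMap.isCoveringMap_of_ncard_fiber {E X : Type*} [TopologicalSpace E]
    [TopologicalSpace X] [T2Space E] {f : E → X} (hc : Continuous f) (ho : IsOpenMap f) {d : ℕ}
    (hd : d ≠ 0) (hf : ∀ x, (f ⁻¹' {x}).ncard = d) : IsCoveringMap f := by
  intro x
  have fin (y : X) : (f ⁻¹' {y}).Finite := Set.finite_of_ncard_ne_zero (by rwa [hf y])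
  obtain ⟨V, hV, disj⟩ := (fin x).t2_separation
  have : Finite (f ⁻¹' {x}) := fin x
  let U : Set X := ⋂ e : f ⁻¹' {x}, f '' V e
  have hU : IsOpen U := isOpen_iInter_of_finite fun e ↦ ho _ (hV e).2
  have hxU : x ∈ U := Set.mem_iInter.2 fun e ↦ ⟨e, (hV e).1, e.2⟩
  have : Nonempty (f ⁻¹' {x}) :=
    (Set.nonempty_of_ncard_ne_zero (by rwa [hf x])).to_subtype
  have : Nonempty E := ⟨(Classical.arbitrary (f ⁻¹' {x})).1⟩
  have : DiscreteTopology (f ⁻¹' {x}) := inferInstance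
  have surj (e : f ⁻¹' {x}) : ∀ y ∈ U, ∃ z ∈ V e, f z = y := fun y hy ↦ Set.mem_iInter.1 hy e
  have eq_of_mem {e₁ e₂ : f ⁻¹' {x}} {z : E} (h₁ : z ∈ V e₁) (h₂ : z ∈ V e₂) : e₁ = e₂ := by
    by_contra h
    exact Set.disjoint_left.1 (disj e₁.2 e₂.2 (Subtype.coe_injective.ne h)) h₁ h₂
  choose! g hgV hgf using surj
  have key (z : E) (hz : f z ∈ U) : ∃ e, g e (f z) = z := by
    have : Finite (f ⁻¹' {f z}) := fin _
    have inj : Function.Injective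
        (fun e ↦ (⟨g e (f z), hgf e _ hz⟩ : f ⁻¹' {f z})) := fun e₁ e₂ h ↦ by
      have h' : g e₁ (f z) = g e₂ (f z) := congrArg Subtype.val h
      exact eq_of_mem (hgV e₁ _ hz) (h' ▸ hgV e₂ _ hz)
    have bij := inj.bijective_of_nat_card_le (by
      rw [Nat.card_coe_set_eq, Nat.card_coe_set_eq, hf, hf])
    obtain ⟨e, he⟩ := bij.2 ⟨z, rfl⟩
    exact ⟨e, congrArg Subtype.val he⟩
  have key' (e : f ⁻¹' {x}) (z : E) (hz : f z ∈ U) (hze : z ∈ V e) : g e (f z) = z := by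
    obtain ⟨e', he'⟩ := key z hz
    rwa [eq_of_mem hze (he' ▸ hgV e' _ hz)]
  refine .of_trivialization (t := hU.trivializationDiscrete
    (fun e : f ⁻¹' {x} ↦ V e ∩ f ⁻¹' U) U (fun e W hW ↦ ⟨fun h ↦ ?_, fun h ↦ ?_⟩)
    (fun e z₁ h₁ z₂ h₂ h ↦ ?_) (fun e y hy ↦ ?_) (fun e₁ e₂ h ↦ ?_) (fun z hz ↦ ?_)) hxU
  · exact (h.preimage hc).inter ((hV e).2.inter (hU.preimage hc))
  · convert! ho _ h
    refine subset_antisymm (fun y hy ↦ ?_) ?_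
    · have := hgf e _ (hW hy)
      exact ⟨g e y, ⟨by rwa [Set.mem_preimage, this], hgV e _ (hW hy),
        by rw [Set.mem_preimage, this]; exact hW hy⟩, this⟩
    · rintro _ ⟨z, hz, rfl⟩
      exact hz.1
  · rw [← key' e z₁ h₁.2 h₁.1, h, key' e z₂ h₂.2 h₂.1]
  · exact ⟨g e y, ⟨hgV e _ hy, by rw [Set.mem_preimage, hgf e _ hy]; exact hy⟩, hgf e _ hy⟩
  · exact Set.disjoint_left.2 fun z h₁ h₂ ↦ h (eq_of_mem h₁.1 h₂.1)
  · obtain ⟨e, he⟩ := key z hz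
    exact Set.mem_iUnion.2 ⟨e, by rw [← he]; exact hgV e _ hz, hz⟩

theorem exists_zero_mem_closedBall {f : ℂ → ℂ} (hf : Differentiable ℂ f) {r : ℝ} (hr : 0 < r)
    (h : ∀ t ∈ Metric.sphere (0 : ℂ) r, ‖f 0‖ < ‖f t‖) :
    ∃ t ∈ Metric.closedBall (0 : ℂ) r, f t = 0 := by
  by_contra! H
  have hcl : closure (Metric.ball (0 : ℂ) r) = Metric.closedBall 0 r := closure_ball _ hr.ne'
  have hd : DiffContOnCl ℂ (fun t ↦ (f t)⁻¹) (Metric.ball 0 r) :=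
    hf.diffContOnCl.inv fun t ht ↦ H t (hcl ▸ ht)
  obtain ⟨z, hz, hmax⟩ := Complex.exists_mem_frontier_isMaxOn_norm Metric.isBounded_ball
    ⟨0, Metric.mem_ball_self hr⟩ hd
  rw [frontier_ball _ hr.ne'] at hz
  have h0 : (0 : ℂ) ∈ Metric.closedBall (0 : ℂ) r := Metric.mem_closedBall_self hr.le
  have := hmax (hcl ▸ h0)
  simp only [Function.comp, Set.mem_ofPred_eq, norm_inv] at this
  exact absurd ((inv_le_inv₀ (norm_pos_iff.2 (H 0 h0))
    (norm_pos_iff.2 (H z (Metric.sphere_subset_closedBall hz)))).1 this) (h z hz).not_ge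

/-- Persistence of zeros in a continuous family of entire functions. -/
theorem eventually_exists_zero_mem_closedBall {X : Type*} [TopologicalSpace X] {g : X → ℂ → ℂ}
    (hg : Continuous fun p : X × ℂ ↦ g p.1 p.2) (hd : ∀ x, Differentiable ℂ (g x)) {x₀ : X}
    (h₀ : g x₀ 0 = 0) (h₁ : ∃ t, g x₀ t ≠ 0) {r : ℝ} (hr : 0 < r) :
    ∀ᶠ x in 𝓝 x₀, ∃ t ∈ Metric.closedBall (0 : ℂ) r, g x t = 0 := by
  have han : AnalyticOnNhd ℂ (g x₀) Set.univ := fun t _ ↦ (hd x₀).analyticAt t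
  have hne : ∀ᶠ t in 𝓝[≠] 0, g x₀ t ≠ 0 := by
    rcases (han 0 trivial).eventually_eq_zero_or_eventually_ne_zero with h | h
    · obtain ⟨t, ht⟩ := h₁
      exact absurd (han.eqOn_zero_of_preconnected_of_eventuallyEq_zero isPreconnected_univ
        (Set.mem_univ 0) h (Set.mem_univ t)) ht
    · exact h
  obtain ⟨ε, hε, hball⟩ := Metric.eventually_nhds_iff.1 (eventually_nhdsWithin_iff.1 hne)
  have hs : 0 < min r (ε / 2) := lt_min hr (by linarith)
  have hsph : ∀ᶠ x in 𝓝 x₀, ∀ t ∈ Metric.sphere (0 : ℂ) (min r (ε / 2)), ‖g x 0‖ < ‖g x t‖ := by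
    refine (isCompact_sphere _ _).eventually_forall_of_forall_eventually fun t ht ↦ ?_
    have hc₀ : Continuous fun p : X × ℂ ↦ ‖g p.1 0‖ :=
      (hg.comp (continuous_fst.prodMk continuous_const)).norm
    refine hc₀.continuousAt.eventually_lt hg.norm.continuousAt ?_
    simp only [h₀, norm_zero, norm_pos_iff]
    refine hball ?_ ?_
    · rw [Metric.mem_sphere.1 ht]
      exact (min_le_right _ _).trans_lt (by linarith)
    · rintro rfl
      simp [hs.ne] at ht
  filter_upwards [hsph] with x hx
  obtain ⟨t, ht, h⟩ := exists_zero_mem_closedBall (hd x) hs hx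
  exact ⟨t, Metric.closedBall_subset_closedBall (min_le_left _ _) ht, h⟩

theorem MvPolynomial.IsHomogeneous.eval_smul_vec {σ R : Type*} [Fintype σ] [CommSemiring R]
    {F : MvPolynomial σ R} {d : ℕ} (hF : F.IsHomogeneous d) (c : R) (x : σ → R) :
    eval (c • x) F = c ^ d * eval x F := by
  rw [eval_eq', eval_eq', Finset.mul_sum]
  refine Finset.sum_congr rfl fun m hm ↦ ?_
  have : ∑ i, m i = d := by
    rw [← hF (mem_support_iff.1 hm), Finsupp.weight_apply, Finsupp.sum_fintype] <;> simp
  simp only [Pi.smul_apply, smul_eq_mul, mul_pow, Finset.prod_mul_distrib,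
    Finset.prod_pow_eq_pow_sum, this]
  ring

open Matrix in
theorem exists_cross_eq {a p : Fin 3 → ℂ} (ha : a ≠ 0) (hp : a ⬝ᵥ p = 0) :
    ∃ u, a ⨯₃ u = p := by
  obtain ⟨i, hi⟩ := Function.ne_iff.1 ha
  refine ⟨p ⨯₃ Pi.single i (a i)⁻¹, ?_⟩
  rw [cross_cross_eq_smul_sub_smul', dotProduct_comm p a, hp, dotProduct_single,
    mul_inv_cancel₀ hi]
  simp

open Matrix in
theorem eventually_exists_zero_on_line (F : MvPolynomial (Fin 3) ℂ) {a p q : Fin 3 → ℂ}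
    (ha : a ≠ 0) (hp : a ⬝ᵥ p = 0) (hq : a ⬝ᵥ q = 0) (hFp : eval p F = 0) (hFq : eval q F ≠ 0)
    {A : Set (Fin 3 → ℂ)} (hA : IsOpen A) (hpA : p ∈ A) :
    ∀ᶠ v in 𝓝 a, ∃ x ∈ A, v ⬝ᵥ x = 0 ∧ eval x F = 0 := by
  obtain ⟨u, rfl⟩ := exists_cross_eq ha hp
  obtain ⟨w, rfl⟩ := exists_cross_eq ha hq
  let γ : (Fin 3 → ℂ) → ℂ → Fin 3 → ℂ := fun v t ↦ v ⨯₃ (u + t • (w - u))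
  have hγ : Continuous fun s : (Fin 3 → ℂ) × ℂ ↦ γ s.1 s.2 := by
    refine continuous_pi fun i ↦ ?_
    fin_cases i <;> simp [γ, cross_apply] <;> fun_prop
  have hγd (v) : Differentiable ℂ (γ v) := by
    refine differentiable_pi.2 fun i ↦ ?_
    fin_cases i <;> simp [γ, cross_apply] <;> fun_prop
  have hev : Differentiable ℂ fun x : Fin 3 → ℂ ↦ eval x F := by
    simp only [eval_eq']
    fun_prop
  have hnhds : ∀ᶠ s : (Fin 3 → ℂ) × ℂ in 𝓝 (a, 0), γ s.1 s.2 ∈ A :=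
    hγ.continuousAt.eventually_mem (hA.mem_nhds (by simpa [γ] using hpA))
  rw [nhds_prod_eq] at hnhds
  obtain ⟨P, hP, Q, hQ, hPQ⟩ := eventually_prod_iff.1 hnhds
  obtain ⟨r, hr, hrQ⟩ := Metric.nhds_basis_closedBall.eventually_iff.1 hQ
  filter_upwards [hP, eventually_exists_zero_mem_closedBall (g := fun v t ↦ eval (γ v t) F)
    (hev.continuous.comp hγ) (fun v ↦ hev.comp (hγd v)) (by simpa [γ] using hFp)
    ⟨1, by simpa [γ] using hFq⟩ hr] with v hv ⟨t, ht, h⟩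
  exact ⟨γ v t, hPQ hv (hrQ ht), dot_self_cross _ _, h⟩

theorem isOpenQuotientMap_mk' :
    IsOpenQuotientMap (Projectivization.mk' ℂ : {v : Fin 3 → ℂ // v ≠ 0} → P2) := by
  refine ⟨Quotient.mk''_surjective, continuous_quot_mk, fun U hU ↦ ?_⟩
  change IsOpen (Projectivization.mk' ℂ ⁻¹' (Projectivization.mk' ℂ '' U))
  have : (Projectivization.mk' ℂ : {v : Fin 3 → ℂ // v ≠ 0} → P2) ⁻¹'
      (Projectivization.mk' ℂ '' U) = ⋃ c : ℂˣ,
        (fun v : {v : Fin 3 → ℂ // v ≠ 0} ↦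
          (⟨c • v.1, (smul_ne_zero_iff_ne c).2 v.2⟩ : {v : Fin 3 → ℂ // v ≠ 0})) ⁻¹' U := by
    ext v
    simp only [Set.mem_preimage, Set.mem_image, Set.mem_iUnion, Projectivization.mk'_eq_mk,
      Projectivization.mk_eq_mk_iff]
    constructor
    · rintro ⟨w, hw, c, hc⟩
      exact ⟨c, by simpa only [hc] using hw⟩
    · rintro ⟨c, hc⟩
      exact ⟨_, hc, c, rfl⟩
  rw [this]
  exact isOpen_iUnion fun c ↦ hU.preimage (by fun_prop)

instance : T2Space P2 := by
  rw [t2Space_iff_of_isOpenQuotientMap isOpenQuotientMap_mk']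
  have : {q : {v : Fin 3 → ℂ // v ≠ 0} × {v : Fin 3 → ℂ // v ≠ 0} |
      (Projectivization.mk' ℂ q.1 : P2) = Projectivization.mk' ℂ q.2} =
      {q | ∀ i j, q.1.1 i * q.2.1 j = q.1.1 j * q.2.1 i} := by
    ext ⟨⟨v, hv⟩, ⟨w, hw⟩⟩
    simp only [Set.mem_ofPred_eq, Projectivization.mk'_eq_mk, Projectivization.mk_eq_mk_iff']
    constructor
    · rintro ⟨c, rfl⟩ i j
      simp only [Pi.smul_apply, smul_eq_mul]
      ring
    · intro h
      obtain ⟨j, hj⟩ := Function.ne_iff.1 hw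
      refine ⟨v j / w j, funext fun i ↦ ?_⟩
      rw [Pi.smul_apply, smul_eq_mul, div_mul_eq_mul_div, div_eq_iff hj, h]
  rw [this]
  simp only [Set.ofPred_forall]
  refine isClosed_iInter fun i ↦ isClosed_iInter fun j ↦ isClosed_eq ?_ ?_ <;>
    [exact ((continuous_apply i).comp (continuous_subtype_val.comp continuous_fst)).mul
      ((continuous_apply j).comp (continuous_subtype_val.comp continuous_snd));
    exact ((continuous_apply j).comp (continuous_subtype_val.comp continuous_fst)).mul
      ((continuous_apply i).comp (continuous_subtype_val.comp continuous_snd))]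

open Matrix in
theorem mk_mem_lineSet_iff {x v : Fin 3 → ℂ} (hx : x ≠ 0) (hv : v ≠ 0) :
    Projectivization.mk ℂ x hx ∈ lineSet (Projectivization.mk ℂ v hv) ↔ v ⬝ᵥ x = 0 := by
  obtain ⟨a, ha⟩ := Projectivization.exists_smul_eq_mk_rep ℂ x hx
  obtain ⟨b, hb⟩ := Projectivization.exists_smul_eq_mk_rep ℂ v hv
  change (Projectivization.mk ℂ v hv).rep ⬝ᵥ (Projectivization.mk ℂ x hx).rep = 0 ↔ _
  rw [← ha, ← hb]
  simp [Units.smul_def]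

theorem mk_mem_curveSet_iff {F : MvPolynomial (Fin 3) ℂ} {d : ℕ} (hF : F.IsHomogeneous d)
    {x : Fin 3 → ℂ} (hx : x ≠ 0) :
    Projectivization.mk ℂ x hx ∈ curveSet F ↔ eval x F = 0 := by
  obtain ⟨a, ha⟩ := Projectivization.exists_smul_eq_mk_rep ℂ x hx
  change eval (Projectivization.mk ℂ x hx).rep F = 0 ↔ _
  rw [← ha, Units.smul_def, hF.eval_smul_vec]
  simp

open Matrix in
theorem lineSet_infinite (ξ : P2) : (lineSet ξ).Infinite := by
  induction ξ using Projectivization.ind with | h v hv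
  let φ : Module.Dual ℂ (Fin 3 → ℂ) := dotProductBilin ℂ ℂ v
  have hφ : φ ≠ 0 := fun h ↦ hv <| dotProduct_eq_zero _ fun w ↦ by
    simpa [φ] using LinearMap.congr_fun h w
  have hrank := Module.Dual.finrank_ker_add_one_of_ne_zero hφ
  rw [Module.finrank_fin_fun] at hrank
  have : Nontrivial (LinearMap.ker φ) := Module.nontrivial_of_finrank_pos (R := ℂ) (by omega)
  obtain ⟨p, hp⟩ := exists_ne (0 : LinearMap.ker φ)
  obtain ⟨q, hpq⟩ := exists_linearIndependent_pair_of_one_lt_finrank (R := ℂ) (by omega) hp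
  rw [LinearIndependent.pair_iff] at hpq
  have hne (t : ℂ) : (p + t • q : LinearMap.ker φ).1 ≠ 0 := fun h ↦
    one_ne_zero (hpq 1 t (by rw [one_smul]; exact Subtype.ext h)).1
  refine Set.infinite_of_injective_forall_mem
    (f := fun t : ℂ ↦ Projectivization.mk ℂ (p + t • q : LinearMap.ker φ).1 (hne t))
    (fun s t h ↦ ?_) (fun t ↦ (mk_mem_lineSet_iff _ _).2 (p + t • q).2)
  obtain ⟨c, hc⟩ := (Projectivization.mk_eq_mk_iff' ..).1 h
  have hc' : c • (p + t • q) = p + s • q := Subtype.ext hc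
  have h0 := hpq (c - 1) (c * t - s) (by
    rw [← sub_eq_zero] at hc'
    rw [← hc']
    module)
  rw [sub_eq_zero.1 h0.1, one_mul] at h0
  exact (sub_eq_zero.1 h0.2).symm

theorem exists_mem_lineSet_notMem_curveSet {F : MvPolynomial (Fin 3) ℂ} {d : ℕ} (hd : d ≠ 0)
    {ξ : P2} (hξ : ξ ∈ transversalLines F d) : ∃ x ∈ lineSet ξ, x ∉ curveSet F := by
  by_contra! h
  have hcard : (curveSet F ∩ lineSet ξ).ncard = d := hξ
  rw [Set.inter_eq_right.2 h, (lineSet_infinite ξ).ncard] at hcard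
  exact hd hcard.symm

theorem eventually_exists_mem_curveSet_inter_lineSet {F : MvPolynomial (Fin 3) ℂ} {d : ℕ}
    (hF : F.IsHomogeneous d) {ξ x y : P2} (hx : x ∈ curveSet F ∩ lineSet ξ)
    (hy : y ∈ lineSet ξ) (hyF : y ∉ curveSet F) {A : Set P2} (hA : IsOpen A) (hxA : x ∈ A) :
    ∀ᶠ η in 𝓝 ξ, ∃ z ∈ A, z ∈ curveSet F ∩ lineSet η := by
  induction ξ using Projectivization.ind with | h a ha
  induction x using Projectivization.ind with | h p hp
  induction y using Projectivization.ind with | h q hq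
  let π : {v : Fin 3 → ℂ // v ≠ 0} → P2 := Projectivization.mk' ℂ
  have hπ : IsOpenQuotientMap π := isOpenQuotientMap_mk'
  have hA' : IsOpen (Subtype.val '' (π ⁻¹' A)) :=
    isOpen_ne.isOpenMap_subtype_val _ (hA.preimage hπ.continuous)
  have key := eventually_exists_zero_on_line F ha ((mk_mem_lineSet_iff hp ha).1 hx.2)
    ((mk_mem_lineSet_iff hq ha).1 hy) ((mk_mem_curveSet_iff hF hp).1 hx.1)
    (mt (mk_mem_curveSet_iff hF hq).2 hyF) hA' ⟨⟨p, hp⟩, hxA, rfl⟩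
  change ∀ᶠ η in 𝓝 (π ⟨a, ha⟩), _
  rw [← hπ.map_nhds_eq, eventually_map]
  filter_upwards [continuous_subtype_val.continuousAt.eventually key] with v hv
  obtain ⟨_, ⟨z, hz, rfl⟩, hvz, hFz⟩ := hv
  exact ⟨π z, hz, (mk_mem_curveSet_iff hF z.2).2 hFz, (mk_mem_lineSet_iff z.2 v.2).2 hvz⟩

theorem isOpenMap_incidenceProj {F : MvPolynomial (Fin 3) ℂ} {d : ℕ} (hd : d ≠ 0)
    (hF : F.IsHomogeneous d) : IsOpenMap (incidenceProj F d) := by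
  rintro _ ⟨W, hW, rfl⟩
  rw [isOpen_iff_mem_nhds]
  rintro _ ⟨⟨⟨x, ξ⟩, hξ, hx⟩, hxW, rfl⟩
  obtain ⟨A, B, hA, hB, hxA, hξB, hAB⟩ := isOpen_prod_iff.1 hW x ξ hxW
  obtain ⟨y, hy, hyF⟩ := exists_mem_lineSet_notMem_curveSet hd hξ
  have key : ∀ᶠ η in 𝓝 ξ, η ∈ B ∧ ∃ z ∈ A, z ∈ curveSet F ∩ lineSet η :=
    (hB.eventually_mem hξB).and (eventually_exists_mem_curveSet_inter_lineSet hF hx hy hyF hA hxA)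
  have hcont : ContinuousAt Subtype.val (⟨ξ, hξ⟩ : transversalLines F d) :=
    continuous_subtype_val.continuousAt
  filter_upwards [hcont.eventually key]
    with η ⟨hηB, z, hzA, hz⟩
  exact ⟨⟨(z, η), η.2, hz⟩, hAB ⟨hzA, hηB⟩, rfl⟩

theorem ncard_incidenceProj_fiber (F : MvPolynomial (Fin 3) ℂ) (d : ℕ)
    (ξ : transversalLines F d) : (incidenceProj F d ⁻¹' {ξ}).ncard = d := by
  have hξ : (curveSet F ∩ lineSet ξ).ncard = d := ξ.2
  refine Eq.trans ?_ hξ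
  refine Set.ncard_congr (fun e _ ↦ e.1.1) ?_ ?_ ?_
  · rintro ⟨⟨x, η⟩, hη, hx⟩ rfl
    exact hx
  · rintro ⟨⟨x, η⟩, hη, hx⟩ ⟨⟨x', η'⟩, hη', hx'⟩ h h' hxx
    obtain rfl : η = ξ := congrArg Subtype.val h
    obtain rfl : η' = ξ := congrArg Subtype.val h'
    exact Subtype.ext (Prod.ext hxx rfl)
  · intro x hx
    exact ⟨⟨(x, ξ), ξ.2, hx⟩, rfl, rfl⟩

/-- For a reduced plane curve `C = {F = 0}` of degree `d ≥ 1`, the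
projection `pr : E → T_C` from the incidence set over the transversal lines is a
topological covering map, and every fiber has exactly `d` elements. -/
theorem incidenceProj_isCoveringMap (F : MvPolynomial (Fin 3) ℂ) (d : ℕ)
    (hd : 1 ≤ d) (hF : F.IsHomogeneous d) (hsq : Squarefree F) :
    IsCoveringMap (incidenceProj F d) ∧
    ∀ ξ : transversalLines F d, Nat.card (incidenceProj F d ⁻¹' {ξ}) = d := by
  have hd₀ : d ≠ 0 := Nat.one_le_iff_ne_zero.1 hd
  refine ⟨(isOpenMap_incidenceProj hd₀ hF).isCoveringMap_of_ncard_fiber ?_ hd₀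
    (ncard_incidenceProj_fiber F d), fun ξ ↦ ?_⟩
  · exact (continuous_snd.comp continuous_subtype_val).subtype_mk _
  · rw [Nat.card_coe_set_eq]
    exact ncard_incidenceProj_fiber F d ξ

end
end

section
/- The set T_C of lines meeting C transversally is a nonempty, open, and path-connected subset of the dual projective plane ℙ̂². -/
open MvPolynomial

noncomputable section

section

open scoped Matrix

/-- The restriction `F(t p + q)` of a ternary form to a parametrised line, as a polynomial in
`t`. -/
def lineRestrict {R : Type*} [CommRing R] [Algebra ℂ R] (F : MvPolynomial (Fin 3) ℂ)
    (p q : Fin 3 → R) : Polynomial R :=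
  aeval (fun i => Polynomial.C (p i) * Polynomial.X + Polynomial.C (q i)) F

/-- The discriminant (up to normalisation) of the restriction of a form of degree `d` to a
parametrised line. -/
def lineDiscr {R : Type*} [CommRing R] [Algebra ℂ R] (F : MvPolynomial (Fin 3) ℂ) (d : ℕ)
    (p q : Fin 3 → R) : R :=
  (lineRestrict F p q).resultant (Polynomial.derivative (lineRestrict F p q)) d (d - 1)

lemma sum_exponents_of_isHomogeneous {F : MvPolynomial (Fin 3) ℂ} {d : ℕ}
    (hF : F.IsHomogeneous d) {m : Fin 3 →₀ ℕ} (hm : m ∈ F.support) :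
    ∑ i ∈ m.support, m i = d := by
  have := hF (mem_support_iff.1 hm)
  simpa [Finsupp.weight_apply, Finsupp.sum] using this

lemma lineRestrict_map {R S : Type*} [CommRing R] [Algebra ℂ R] [CommRing S] [Algebra ℂ S]
    (φ : R →ₐ[ℂ] S) (F : MvPolynomial (Fin 3) ℂ) (p q : Fin 3 → R) :
    (lineRestrict F p q).map (φ : R →+* S) =
      lineRestrict F (fun i => φ (p i)) (fun i => φ (q i)) := by
  have h : (Polynomial.mapAlgHom φ).comp
      (aeval (fun i => Polynomial.C (p i) * Polynomial.X + Polynomial.C (q i))) =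
      aeval (fun i => Polynomial.C (φ (p i)) * Polynomial.X + Polynomial.C (φ (q i))) := by
    ext i : 1
    simp
  simpa [lineRestrict] using DFunLike.congr_fun h F

lemma lineDiscr_map {R S : Type*} [CommRing R] [Algebra ℂ R] [CommRing S] [Algebra ℂ S]
    (φ : R →ₐ[ℂ] S) (F : MvPolynomial (Fin 3) ℂ) (d : ℕ) (p q : Fin 3 → R) :
    φ (lineDiscr F d p q) = lineDiscr F d (fun i => φ (p i)) (fun i => φ (q i)) := by
  rw [lineDiscr, lineDiscr, ← lineRestrict_map, Polynomial.derivative_map,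
    Polynomial.resultant_map_map]
  rfl

lemma eval_lineRestrict (F : MvPolynomial (Fin 3) ℂ) (p q : Fin 3 → ℂ) (t : ℂ) :
    (lineRestrict F p q).eval t = eval (t • p + q) F := by
  have h : (Polynomial.aeval t).comp
      (aeval (fun i => Polynomial.C (p i) * Polynomial.X + Polynomial.C (q i))) =
      aeval (t • p + q) := by
    ext i : 1
    simp only [AlgHom.comp_apply, aeval_X, map_add, map_mul, Polynomial.aeval_C,
      Polynomial.aeval_X, Pi.add_apply, Pi.smul_apply, smul_eq_mul, Algebra.algebraMap_self_apply,
      mul_comm]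
  exact DFunLike.congr_fun h F

lemma natDegree_lineRestrict_le {R : Type*} [CommRing R] [Algebra ℂ R]
    {F : MvPolynomial (Fin 3) ℂ} {d : ℕ} (hF : F.IsHomogeneous d) (p q : Fin 3 → R) :
    (lineRestrict F p q).natDegree ≤ d := by
  rw [lineRestrict, aeval_def, eval₂_eq]
  refine Polynomial.natDegree_sum_le_of_forall_le _ _ fun m hm => ?_
  have hdeg := sum_exponents_of_isHomogeneous hF hm
  rw [IsScalarTower.algebraMap_apply ℂ R (Polynomial R), Polynomial.algebraMap_eq]
  refine (Polynomial.natDegree_C_mul_le _ _).trans ((Polynomial.natDegree_prod_le _ _).trans ?_)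
  rw [← hdeg]
  exact Finset.sum_le_sum fun i _ => Polynomial.natDegree_pow_le_of_le _
    Polynomial.natDegree_linear_le |>.trans (by simp)

lemma coeff_lineRestrict {R : Type*} [CommRing R] [Algebra ℂ R]
    {F : MvPolynomial (Fin 3) ℂ} {d : ℕ} (hF : F.IsHomogeneous d) (p q : Fin 3 → R) :
    (lineRestrict F p q).coeff d = aeval p F := by
  rw [lineRestrict, aeval_def, eval₂_eq, aeval_def, eval₂_eq, Polynomial.finsetSum_coeff]
  refine Finset.sum_congr rfl fun m hm => ?_
  have hdeg := sum_exponents_of_isHomogeneous hF hm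
  rw [IsScalarTower.algebraMap_apply ℂ R (Polynomial R), Polynomial.algebraMap_eq,
    Polynomial.coeff_C_mul, ← hdeg]
  congr 1
  induction m.support using Finset.cons_induction with
  | empty => simp
  | cons i s hi ih =>
    rw [Finset.prod_cons, Finset.sum_cons, Finset.prod_cons,
      Polynomial.coeff_mul_add_eq_of_natDegree_le, ih]
    · congr 1
      simpa using Polynomial.coeff_pow_of_natDegree_le (m := m i) (n := 1)
        (Polynomial.natDegree_linear_le (a := p i) (b := q i))
    · exact (Polynomial.natDegree_pow_le_of_le _ Polynomial.natDegree_linear_le).trans (by simp)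
    · exact (Polynomial.natDegree_prod_le _ _).trans (Finset.sum_le_sum fun i _ =>
        (Polynomial.natDegree_pow_le_of_le _ Polynomial.natDegree_linear_le).trans (by simp))

lemma Polynomial.separable_iff_resultant_derivative_ne_zero {k : Type*} [Field k] [CharZero k]
    {f : Polynomial k} {d : ℕ} (hf : f ≠ 0) (hd : f.natDegree = d) :
    f.Separable ↔ f.resultant (Polynomial.derivative f) d (d - 1) ≠ 0 := by
  have h : (Polynomial.derivative f).natDegree = d - 1 := by
    rw [Polynomial.natDegree_derivative, hd]
  rw [← h, ← hd, Ne, Polynomial.resultant_eq_zero_iff, Polynomial.Separable]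
  tauto

lemma eval_smul_of_isHomogeneous {F : MvPolynomial (Fin 3) ℂ} {d : ℕ} (hF : F.IsHomogeneous d)
    (c : ℂ) (x : Fin 3 → ℂ) : eval (c • x) F = c ^ d * eval x F := by
  rw [eval_eq, eval_eq, Finset.mul_sum]
  refine Finset.sum_congr rfl fun m hm => ?_
  have hdeg := sum_exponents_of_isHomogeneous hF hm
  simp only [Pi.smul_apply, smul_eq_mul, mul_pow, Finset.prod_mul_distrib,
    Finset.prod_pow_eq_pow_sum, hdeg]
  ring

lemma mk_mem_curveSet {F : MvPolynomial (Fin 3) ℂ} {d : ℕ} (hF : F.IsHomogeneous d)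
    {x : Fin 3 → ℂ} (hx : x ≠ 0) :
    (Projectivization.mk ℂ x hx : P2) ∈ curveSet F ↔ eval x F = 0 := by
  obtain ⟨a, ha⟩ := Projectivization.exists_smul_eq_mk_rep ℂ x hx
  rw [curveSet, Set.mem_ofPred_eq, ← ha, Units.smul_def, eval_smul_of_isHomogeneous hF]
  simp

lemma mk_mem_lineSet {a x : Fin 3 → ℂ} (ha : a ≠ 0) (hx : x ≠ 0) :
    (Projectivization.mk ℂ x hx : P2) ∈ lineSet (Projectivization.mk ℂ a ha) ↔ a ⬝ᵥ x = 0 := by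
  obtain ⟨u, hu⟩ := Projectivization.exists_smul_eq_mk_rep ℂ x hx
  obtain ⟨v, hv⟩ := Projectivization.exists_smul_eq_mk_rep ℂ a ha
  change _ ⬝ᵥ _ = 0 ↔ _
  rw [← hu, ← hv, Units.smul_def, Units.smul_def, smul_dotProduct, dotProduct_smul]
  simp

lemma cross_smul_add (p q : Fin 3 → ℂ) (t : ℂ) : p ⨯₃ (t • p + q) = p ⨯₃ q := by
  simp

lemma smul_add_ne_zero {p q : Fin 3 → ℂ} (h : p ⨯₃ q ≠ 0) (t : ℂ) : t • p + q ≠ 0 := by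
  intro h0
  apply h
  rw [← cross_smul_add p q t, h0, map_zero]

/-- The affine parametrisation `t ↦ [t p + q]` of the line through `[p]` and `[q]`. -/
def linePoint {p q : Fin 3 → ℂ} (h : p ⨯₃ q ≠ 0) (t : ℂ) : P2 :=
  Projectivization.mk ℂ (t • p + q) (smul_add_ne_zero h t)

lemma linePoint_injective {p q : Fin 3 → ℂ} (h : p ⨯₃ q ≠ 0) :
    Function.Injective (linePoint h) := by
  intro s t hst
  obtain ⟨u, hu⟩ := (Projectivization.mk_eq_mk_iff' ℂ _ _ _ _).1 hst
  have h1 : u = 1 := by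
    have := congrArg (fun x => p ⨯₃ x) hu
    simp only [map_smul, cross_smul_add] at this
    have h2 : (u - 1) • (p ⨯₃ q) = 0 := by rw [sub_smul, this, one_smul, sub_self]
    simpa [h, sub_eq_zero] using h2
  have hp : p ≠ 0 := by
    rintro rfl
    simp at h
  have h2 : (t - s) • p = 0 := by
    rw [h1, one_smul] at hu
    rw [sub_smul, add_right_cancel hu, sub_self]
  have := (smul_eq_zero.1 h2).resolve_right hp
  exact (sub_eq_zero.1 this).symm

lemma linePoint_mem_lineSet {p q : Fin 3 → ℂ} (h : p ⨯₃ q ≠ 0) (t : ℂ) :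
    linePoint h t ∈ lineSet (Projectivization.mk ℂ (p ⨯₃ q) h) := by
  rw [linePoint, mk_mem_lineSet, dotProduct_add, dotProduct_smul, dotProduct_comm,
    dot_self_cross, dotProduct_comm, dot_cross_self]
  simp

lemma linePoint_mem_curveSet {F : MvPolynomial (Fin 3) ℂ} {d : ℕ} (hF : F.IsHomogeneous d)
    {p q : Fin 3 → ℂ} (h : p ⨯₃ q ≠ 0) (t : ℂ) :
    linePoint h t ∈ curveSet F ↔ (lineRestrict F p q).IsRoot t := by
  rw [linePoint, mk_mem_curveSet hF, Polynomial.IsRoot, eval_lineRestrict]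

lemma exists_eq_smul_add_smul {p q x : Fin 3 → ℂ} (h : p ⨯₃ q ≠ 0) (hx : (p ⨯₃ q) ⬝ᵥ x = 0) :
    ∃ u v : ℂ, x = u • p + v • q := by
  obtain ⟨i, hi⟩ := Function.ne_iff.1 h
  simp only [cross_apply, Matrix.vec3_dotProduct] at hx hi
  simp at hx
  fin_cases i <;> simp at hi
  · obtain ⟨D, hD⟩ : ∃ D, D = p 1 * q 2 - p 2 * q 1 := ⟨_, rfl⟩
    rw [← hD] at hi
    refine ⟨(x 1 * q 2 - x 2 * q 1) / D, (p 1 * x 2 - p 2 * x 1) / D, ?_⟩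
    ext i
    fin_cases i <;> simp <;> field_simp <;> rw [hD] <;> first | linear_combination hx | ring1
  · obtain ⟨D, hD⟩ : ∃ D, D = p 2 * q 0 - p 0 * q 2 := ⟨_, rfl⟩
    rw [← hD] at hi
    refine ⟨(x 2 * q 0 - x 0 * q 2) / D, (p 2 * x 0 - p 0 * x 2) / D, ?_⟩
    ext i
    fin_cases i <;> simp <;> field_simp <;> rw [hD] <;> first | linear_combination hx | ring1
  · obtain ⟨D, hD⟩ : ∃ D, D = p 0 * q 1 - p 1 * q 0 := ⟨_, rfl⟩
    rw [← hD] at hi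
    refine ⟨(x 0 * q 1 - x 1 * q 0) / D, (p 0 * x 1 - p 1 * x 0) / D, ?_⟩
    ext i
    fin_cases i <;> simp <;> field_simp <;> rw [hD] <;> first | linear_combination hx | ring1

lemma lineRestrict_ne_zero {F : MvPolynomial (Fin 3) ℂ} {d : ℕ} (hF : F.IsHomogeneous d)
    {p : Fin 3 → ℂ} (hp : eval p F ≠ 0) (q : Fin 3 → ℂ) : lineRestrict F p q ≠ 0 := by
  intro h0
  apply hp
  change aeval p F = 0
  rw [← coeff_lineRestrict hF p q, h0, Polynomial.coeff_zero]

lemma natDegree_lineRestrict {F : MvPolynomial (Fin 3) ℂ} {d : ℕ} (hF : F.IsHomogeneous d)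
    {p : Fin 3 → ℂ} (hp : eval p F ≠ 0) (q : Fin 3 → ℂ) : (lineRestrict F p q).natDegree = d := by
  refine le_antisymm (natDegree_lineRestrict_le hF p q) (Polynomial.le_natDegree_of_ne_zero ?_)
  rwa [coeff_lineRestrict hF]

lemma curveSet_inter_lineSet {F : MvPolynomial (Fin 3) ℂ} {d : ℕ} (hF : F.IsHomogeneous d)
    {p q : Fin 3 → ℂ} (h : p ⨯₃ q ≠ 0) (hp : eval p F ≠ 0) :
    curveSet F ∩ lineSet (Projectivization.mk ℂ (p ⨯₃ q) h) =
      linePoint h '' ((lineRestrict F p q).roots.toFinset : Set ℂ) := by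
  ext ξ
  constructor
  · rintro ⟨hξF, hξ⟩
    induction ξ using Projectivization.ind with
    | _ x hx =>
    rw [mk_mem_lineSet] at hξ
    obtain ⟨u, v, rfl⟩ := exists_eq_smul_add_smul h hξ
    have hv : v ≠ 0 := by
      rintro rfl
      rw [mk_mem_curveSet hF, zero_smul, add_zero, eval_smul_of_isHomogeneous hF] at hξF
      have hu : u = 0 := eq_zero_of_pow_eq_zero ((mul_eq_zero.1 hξF).resolve_right hp)
      simp [hu] at hx
    have hpt : (Projectivization.mk ℂ (u • p + v • q) hx : P2) = linePoint h (u / v) := by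
      refine (Projectivization.mk_eq_mk_iff' ℂ _ _ _ _).2 ⟨v, ?_⟩
      rw [smul_add, smul_smul, mul_div_cancel₀ _ hv]
    rw [hpt] at hξF ⊢
    refine ⟨u / v, ?_, rfl⟩
    rw [linePoint_mem_curveSet hF] at hξF
    simpa [lineRestrict_ne_zero hF hp] using hξF
  · rintro ⟨t, ht, rfl⟩
    refine ⟨(linePoint_mem_curveSet hF h t).2 ?_, linePoint_mem_lineSet h t⟩
    simpa [lineRestrict_ne_zero hF hp] using ht

lemma mk_cross_mem_transversalLines_iff {F : MvPolynomial (Fin 3) ℂ} {d : ℕ}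
    (hF : F.IsHomogeneous d) {p q : Fin 3 → ℂ} (h : p ⨯₃ q ≠ 0) (hp : eval p F ≠ 0) :
    (Projectivization.mk ℂ (p ⨯₃ q) h : P2) ∈ transversalLines F d ↔ lineDiscr F d p q ≠ 0 := by
  have hdeg := natDegree_lineRestrict hF hp q
  have h0 := lineRestrict_ne_zero hF hp q
  have hsplit := IsAlgClosed.splits (lineRestrict F p q)
  rw [transversalLines, Set.mem_ofPred_eq, curveSet_inter_lineSet hF h hp,
    Set.ncard_image_of_injective _ (linePoint_injective h), Set.ncard_coe_finset, lineDiscr,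
    ← Polynomial.separable_iff_resultant_derivative_ne_zero h0 hdeg,
    ← Polynomial.nodup_roots_iff_of_splits h0 hsplit, ← Multiset.toFinset_card_eq_card_iff_nodup,
    ← hsplit.natDegree_eq_card_roots, hdeg]

lemma Polynomial.IsPrimitive.squarefree_map_fraction {A K : Type*} [CommRing A] [IsDomain A]
    [NormalizedGCDMonoid A] [Field K] [Algebra A K] [IsFractionRing A K] {f : Polynomial A}
    (hf : f.IsPrimitive) (hsq : Squarefree f) : Squarefree (f.map (algebraMap A K)) := by
  intro g hg
  have hf0 : f.map (algebraMap A K) ≠ 0 :=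
    (Polynomial.map_ne_zero_iff (IsFractionRing.injective A K)).2 hf.ne_zero
  have hg0 : g ≠ 0 := by
    rintro rfl
    exact hf0 (by simpa using hg)
  set n := IsLocalization.integerNormalization (nonZeroDivisors A) g with hn
  obtain ⟨c, hc, hcn⟩ := IsLocalization.integerNormalization_spec (nonZeroDivisors A) g
  have hc0 : algebraMap A K c ≠ 0 := IsFractionRing.to_map_ne_zero_of_mem_nonZeroDivisors hc
  have hdvd : n.primPart.map (algebraMap A K) ∣ g := by
    have h1 : n.primPart.map (algebraMap A K) ∣ n.map (algebraMap A K) :=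
      Polynomial.map_dvd _ n.primPart_dvd
    rw [hn, hcn, algebra_compatible_smul K c g, Polynomial.smul_eq_C_mul] at h1
    exact ((Polynomial.isUnit_C.2 hc0.isUnit).dvd_mul_left).1 h1
  have hdvd2 : n.primPart * n.primPart ∣ f := by
    refine (n.isPrimitive_primPart.mul n.isPrimitive_primPart).dvd_of_fraction_map_dvd_fraction_map
      (K := K) ?_
    rw [Polynomial.map_mul]
    exact (mul_dvd_mul hdvd hdvd).trans hg
  exact Polynomial.isUnit_or_eq_zero_of_isUnit_integerNormalization_primPart hg0 (hsq _ hdvd2)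

lemma Squarefree.map_mulEquiv {M N : Type*} [CommMonoid M] [CommMonoid N] (e : M ≃* N) {x : M}
    (hx : Squarefree x) : Squarefree (e x) := by
  intro y hy
  have h : IsUnit (e.symm y) := hx _ (by simpa using map_dvd e.symm hy)
  simpa using h.map e

/-- The linear change of coordinates sending the first basis vector to `(1, b, c)` and fixing the
other two. -/
def shearEquiv (b c : ℂ) : MvPolynomial (Fin 3) ℂ ≃ₐ[ℂ] MvPolynomial (Fin 3) ℂ :=
  AlgEquiv.ofAlgHom (aeval ![X 0, X 1 + C b * X 0, X 2 + C c * X 0])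
    (aeval ![X 0, X 1 - C b * X 0, X 2 - C c * X 0])
    (by ext i : 1; fin_cases i <;> simp [algHom_C]) (by ext i : 1; fin_cases i <;> simp [algHom_C])

lemma lineRestrict_eq_finSuccEquiv (F : MvPolynomial (Fin 3) ℂ) (b c : ℂ) :
    lineRestrict F (fun i => C (![1, b, c] i)) ![0, X 0, X 1] =
      finSuccEquiv ℂ 2 (shearEquiv b c F) := by
  have h : (aeval fun i => Polynomial.C ((C (![1, b, c] i) : MvPolynomial (Fin 2) ℂ)) *
      Polynomial.X + Polynomial.C (![0, X 0, X 1] i)) =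
      ((shearEquiv b c).trans (finSuccEquiv ℂ 2)).toAlgHom := by
    ext i : 1
    have h1 : finSuccEquiv ℂ 2 (X 1) = Polynomial.C (X 0) := finSuccEquiv_X_succ (j := 0)
    have h2 : finSuccEquiv ℂ 2 (X 2) = Polynomial.C (X 1) := finSuccEquiv_X_succ (j := 1)
    have h0 : ∀ z : ℂ, finSuccEquiv ℂ 2 (C z) = Polynomial.C (C z) := fun z =>
      (finSuccEquiv ℂ 2).commutes z
    fin_cases i
    · simp [shearEquiv, finSuccEquiv_X_zero]
    · simp [shearEquiv, finSuccEquiv_X_zero, h1, h0, add_comm]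
    · simp [shearEquiv, finSuccEquiv_X_zero, h2, h0, add_comm]
  exact DFunLike.congr_fun h F

lemma exists_eval_ne_zero {σ : Type*} {G : MvPolynomial σ ℂ} (hG : G ≠ 0) :
    ∃ x, eval x G ≠ 0 := by
  by_contra! h
  exact hG (MvPolynomial.funext (by simpa using h))

lemma lineDiscr_ne_zero {F : MvPolynomial (Fin 3) ℂ} {d : ℕ}
    (hF : F.IsHomogeneous d) (hsq : Squarefree F) {b c : ℂ} (hp : eval ![1, b, c] F ≠ 0) :
    lineDiscr F d (fun i => C (![1, b, c] i)) (![0, X 0, X 1] : Fin 3 → MvPolynomial (Fin 2) ℂ)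
      ≠ 0 := by
  set P : Fin 3 → MvPolynomial (Fin 2) ℂ := fun i => C (![1, b, c] i)
  set Q : Fin 3 → MvPolynomial (Fin 2) ℂ := ![0, X 0, X 1]
  set f := lineRestrict F P Q with hf
  have hfsq : Squarefree f := by
    rw [hf, lineRestrict_eq_finSuccEquiv]
    exact (hsq.map_mulEquiv (shearEquiv b c).toMulEquiv).map_mulEquiv
      (finSuccEquiv ℂ 2).toMulEquiv
  have hcoeff : f.coeff d = C (eval ![1, b, c] F) := by
    rw [hf, coeff_lineRestrict hF]
    exact (aeval_algebraMap_apply (MvPolynomial (Fin 2) ℂ) ![1, b, c] F)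
  have hprim : f.IsPrimitive := by
    intro r hr
    refine isUnit_of_dvd_unit ((Polynomial.C_dvd_iff_dvd_coeff _ _).1 hr d) ?_
    rw [hcoeff]
    exact hp.isUnit.map C
  let : NormalizedGCDMonoid (MvPolynomial (Fin 2) ℂ) := Nonempty.some inferInstance
  let K := FractionRing (MvPolynomial (Fin 2) ℂ)
  have hinj : Function.Injective (algebraMap (MvPolynomial (Fin 2) ℂ) K) :=
    IsFractionRing.injective (MvPolynomial (Fin 2) ℂ) K
  have : CharZero K := charZero_of_injective_algebraMap (algebraMap ℂ K).injective
  have hsep : (f.map (algebraMap _ K)).Separable :=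
    PerfectField.separable_iff_squarefree.2 (hprim.squarefree_map_fraction hfsq)
  have hdeg : (f.map (algebraMap _ K)).natDegree = d := by
    rw [Polynomial.natDegree_map_eq_of_injective hinj]
    refine le_antisymm (natDegree_lineRestrict_le hF P Q) (Polynomial.le_natDegree_of_ne_zero ?_)
    rw [hcoeff]
    simpa using hp
  rw [Polynomial.separable_iff_resultant_derivative_ne_zero hsep.ne_zero hdeg,
    Polynomial.derivative_map, Polynomial.resultant_map_map] at hsep
  intro h0
  apply hsep
  change algebraMap _ K (lineDiscr F d P Q) = 0
  rw [h0, map_zero]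

lemma transversalLines_nonempty {F : MvPolynomial (Fin 3) ℂ} {d : ℕ}
    (hF : F.IsHomogeneous d) (hsq : Squarefree F) : (transversalLines F d).Nonempty := by
  obtain ⟨v, hv⟩ := exists_eval_ne_zero (mul_ne_zero (X_ne_zero (0 : Fin 3)) hsq.ne_zero)
  simp only [map_mul, eval_X, mul_ne_zero_iff] at hv
  have hp : eval ![1, v 1 / v 0, v 2 / v 0] F ≠ 0 := by
    have h : ![1, v 1 / v 0, v 2 / v 0] = (v 0)⁻¹ • v := by
      ext i
      fin_cases i <;> simp [hv.1, div_eq_inv_mul]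
    rw [h, eval_smul_of_isHomogeneous hF]
    simp [hv]
  obtain ⟨s, hs⟩ := exists_eval_ne_zero
    (mul_ne_zero (X_ne_zero (0 : Fin 2)) (lineDiscr_ne_zero hF hsq hp))
  simp only [map_mul, eval_X, mul_ne_zero_iff] at hs
  have hq : (fun i => aeval s ((![0, X 0, X 1] : Fin 3 → MvPolynomial (Fin 2) ℂ) i)) =
      ![0, s 0, s 1] := by
    ext i
    fin_cases i <;> simp
  have hdisc : lineDiscr F d ![1, v 1 / v 0, v 2 / v 0] ![0, s 0, s 1] ≠ 0 := by
    have := lineDiscr_map (aeval s) F d (fun i => C (![1, v 1 / v 0, v 2 / v 0] i))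
      (![0, X 0, X 1] : Fin 3 → MvPolynomial (Fin 2) ℂ)
    rw [hq] at this
    simp only [algHom_C, Algebra.algebraMap_self_apply] at this
    rw [← this]
    exact hs.2
  have hcross : ![1, v 1 / v 0, v 2 / v 0] ⨯₃ ![0, s 0, s 1] ≠ 0 := by
    intro h
    have := congrFun h 2
    simp [cross_apply, hs.1] at this
  exact ⟨_, (mk_cross_mem_transversalLines_iff hF hcross hp).2 hdisc⟩

/-- A polynomial expression in `a` whose non-vanishing forces the line with coefficient vector `a`
to be transversal to the curve `F = 0`; the cross products with `a` span that line. -/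
def transversalityPoly {R : Type*} [CommRing R] [Algebra ℂ R] (F : MvPolynomial (Fin 3) ℂ)
    (d : ℕ) (a w w' : Fin 3 → R) : R :=
  (a ⬝ᵥ w ⨯₃ w') * aeval (a ⨯₃ w) F * lineDiscr F d (a ⨯₃ w) (a ⨯₃ w')

lemma map_cross {R S : Type*} [CommRing R] [CommRing S] (φ : R →+* S) (v w : Fin 3 → R) :
    (fun i => φ ((v ⨯₃ w) i)) = (fun i => φ (v i)) ⨯₃ (fun i => φ (w i)) := by
  ext i
  fin_cases i <;> simp [cross_apply]

lemma transversalityPoly_map {R S : Type*} [CommRing R] [Algebra ℂ R] [CommRing S] [Algebra ℂ S]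
    (φ : R →ₐ[ℂ] S) (F : MvPolynomial (Fin 3) ℂ) (d : ℕ) (a w w' : Fin 3 → R) :
    φ (transversalityPoly F d a w w') =
      transversalityPoly F d (fun i => φ (a i)) (fun i => φ (w i)) (fun i => φ (w' i)) := by
  have h (v w : Fin 3 → R) : (fun i => φ ((v ⨯₃ w) i)) =
    (fun i => φ (v i)) ⨯₃ (fun i => φ (w i)) := map_cross (φ : R →+* S) v w
  have h2 : φ (aeval (a ⨯₃ w) F) = aeval (fun i => φ ((a ⨯₃ w) i)) F := by
    rw [← AlgHom.comp_apply, comp_aeval]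
  have h3 : φ (a ⬝ᵥ w ⨯₃ w') = (fun i => φ (a i)) ⬝ᵥ fun i => φ ((w ⨯₃ w') i) := by
    simp [dotProduct]
  rw [transversalityPoly, transversalityPoly, map_mul, map_mul, lineDiscr_map, h2, h3, h, h, h]

lemma cross_cross_common {R : Type*} [CommRing R] (a w w' : Fin 3 → R) :
    (a ⨯₃ w) ⨯₃ (a ⨯₃ w') = (a ⬝ᵥ w ⨯₃ w') • a := by
  ext i
  fin_cases i <;> simp [cross_apply, Matrix.vecHead, Matrix.vecTail] <;> ring

lemma mk_mem_transversalLines_iff {F : MvPolynomial (Fin 3) ℂ} {d : ℕ}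
    (hF : F.IsHomogeneous d) {a w w' : Fin 3 → ℂ} (ha : a ≠ 0) (hdet : a ⬝ᵥ w ⨯₃ w' ≠ 0)
    (hw : eval (a ⨯₃ w) F ≠ 0) :
    (Projectivization.mk ℂ a ha : P2) ∈ transversalLines F d ↔
      lineDiscr F d (a ⨯₃ w) (a ⨯₃ w') ≠ 0 := by
  have hc := cross_cross_common a w w'
  have h : (a ⨯₃ w) ⨯₃ (a ⨯₃ w') ≠ 0 := by
    rw [hc]
    exact smul_ne_zero hdet ha
  rw [← mk_cross_mem_transversalLines_iff hF h hw,
    (Projectivization.mk_eq_mk_iff' ℂ _ _ h ha).2 ⟨_, hc.symm⟩]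

lemma ne_zero_of_transversalityPoly_ne_zero {F : MvPolynomial (Fin 3) ℂ} {d : ℕ}
    {a w w' : Fin 3 → ℂ} (h : transversalityPoly F d a w w' ≠ 0) : a ≠ 0 := by
  rintro rfl
  simp [transversalityPoly] at h

lemma mk_mem_transversalLines {F : MvPolynomial (Fin 3) ℂ} {d : ℕ} (hF : F.IsHomogeneous d)
    {a w w' : Fin 3 → ℂ} (h : transversalityPoly F d a w w' ≠ 0) (ha : a ≠ 0) :
    (Projectivization.mk ℂ a ha : P2) ∈ transversalLines F d := by
  rw [transversalityPoly, mul_ne_zero_iff, mul_ne_zero_iff] at h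
  exact (mk_mem_transversalLines_iff hF ha h.1.1 h.1.2).2 h.2

lemma exists_dotProduct_cross_ne_zero {a : Fin 3 → ℂ} (ha : a ≠ 0) :
    ∃ w w' : Fin 3 → ℂ, a ⬝ᵥ w ⨯₃ w' ≠ 0 := by
  obtain ⟨i, hi⟩ := Function.ne_iff.1 ha
  fin_cases i
  · exact ⟨![0, 1, 0], ![0, 0, 1], by simpa [cross_apply, Matrix.vecHead, Matrix.vecTail] using hi⟩
  · exact ⟨![0, 0, 1], ![1, 0, 0], by simpa [cross_apply, Matrix.vecHead, Matrix.vecTail] using hi⟩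
  · exact ⟨![1, 0, 0], ![0, 1, 0], by simpa [cross_apply, Matrix.vecHead, Matrix.vecTail] using hi⟩

lemma exists_eval_cross_ne_zero {F : MvPolynomial (Fin 3) ℂ} {d : ℕ} (hd : 1 ≤ d)
    (hF : F.IsHomogeneous d) {a : Fin 3 → ℂ} (ha : a ≠ 0)
    (h : (Projectivization.mk ℂ a ha : P2) ∈ transversalLines F d) :
    ∃ w : Fin 3 → ℂ, eval (a ⨯₃ w) F ≠ 0 := by
  by_contra! hall
  obtain ⟨w, w', hdet⟩ := exists_dotProduct_cross_ne_zero ha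
  have hc := cross_cross_common a w w'
  have h0 : (a ⨯₃ w) ⨯₃ (a ⨯₃ w') ≠ 0 := by
    rw [hc]
    exact smul_ne_zero hdet ha
  rw [← (Projectivization.mk_eq_mk_iff' ℂ _ _ h0 ha).2 ⟨_, hc.symm⟩] at h
  have hinf : (curveSet F ∩ lineSet (Projectivization.mk ℂ _ h0)).Infinite := by
    refine (Set.infinite_range_of_injective (linePoint_injective h0)).mono ?_
    rintro _ ⟨t, rfl⟩
    refine ⟨?_, linePoint_mem_lineSet h0 t⟩
    rw [linePoint_mem_curveSet hF, Polynomial.IsRoot, eval_lineRestrict, ← map_smul, ← map_add]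
    exact hall _
  rw [transversalLines, Set.mem_ofPred_eq, hinf.ncard] at h
  lia

lemma exists_eval_ne_zero_and_eval_ne_zero {σ : Type*} {G H : MvPolynomial σ ℂ}
    (hG : ∃ x, eval x G ≠ 0) (hH : ∃ x, eval x H ≠ 0) : ∃ x, eval x G ≠ 0 ∧ eval x H ≠ 0 := by
  have hG0 : G ≠ 0 := by
    rintro rfl
    simp at hG
  have hH0 : H ≠ 0 := by
    rintro rfl
    simp at hH
  simpa [mul_ne_zero_iff] using exists_eval_ne_zero (mul_ne_zero hG0 hH0)

lemma exists_transversalityPoly_ne_zero {F : MvPolynomial (Fin 3) ℂ} {d : ℕ} (hd : 1 ≤ d)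
    (hF : F.IsHomogeneous d) {a b : Fin 3 → ℂ} (ha : a ≠ 0) (hb : b ≠ 0)
    (haT : (Projectivization.mk ℂ a ha : P2) ∈ transversalLines F d)
    (hbT : (Projectivization.mk ℂ b hb : P2) ∈ transversalLines F d) :
    ∃ w w' : Fin 3 → ℂ, transversalityPoly F d a w w' ≠ 0 ∧ transversalityPoly F d b w w' ≠ 0 := by
  have heval (v w : Fin 3 → ℂ) :
      eval w (aeval ((fun i => C (v i)) ⨯₃ (X : Fin 3 → MvPolynomial (Fin 3) ℂ)) F) =
        eval (v ⨯₃ w) F := by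
    have h1 : aeval w (aeval ((fun i => C (v i)) ⨯₃ (X : Fin 3 → MvPolynomial (Fin 3) ℂ)) F) =
        aeval (fun i => aeval w (((fun i => C (v i)) ⨯₃
          (X : Fin 3 → MvPolynomial (Fin 3) ℂ)) i)) F := by
      rw [← AlgHom.comp_apply, comp_aeval]
    have h2 := map_cross (eval w) (fun i => C (v i)) (X : Fin 3 → MvPolynomial (Fin 3) ℂ)
    simp only [eval_C, eval_X] at h2
    rw [← h2]
    exact h1
  have hlin (v w : Fin 3 → ℂ) : eval w (∑ i, C (v i) * X i) = v ⬝ᵥ w := by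
    simp [dotProduct]
  have hdot {v : Fin 3 → ℂ} (hv : v ≠ 0) : ∃ w, v ⬝ᵥ w ≠ 0 := by
    obtain ⟨i, hi⟩ := Function.ne_iff.1 hv
    exact ⟨Pi.single i 1, by simpa using hi⟩
  have hne {v : Fin 3 → ℂ} (hv : eval v F ≠ 0) : v ≠ 0 := by
    rintro rfl
    have := eval_smul_of_isHomogeneous hF 0 0
    rw [zero_smul, zero_pow (by lia), zero_mul] at this
    exact hv this
  obtain ⟨w, hwa, hwb⟩ := exists_eval_ne_zero_and_eval_ne_zero
    ((exists_eval_cross_ne_zero hd hF ha haT).imp fun w hw => (heval a w).trans_ne hw)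
    ((exists_eval_cross_ne_zero hd hF hb hbT).imp fun w hw => (heval b w).trans_ne hw)
  rw [heval] at hwa hwb
  obtain ⟨w', ha', hb'⟩ := exists_eval_ne_zero_and_eval_ne_zero
    ((hdot (hne hwa)).imp fun w' h => (hlin _ w').trans_ne h)
    ((hdot (hne hwb)).imp fun w' h => (hlin _ w').trans_ne h)
  rw [hlin, dotProduct_comm, ← triple_product_permutation, ← triple_product_permutation] at ha' hb'
  exact ⟨w, w',
    mul_ne_zero (mul_ne_zero ha' hwa) ((mk_mem_transversalLines_iff hF ha ha' hwa).1 haT),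
    mul_ne_zero (mul_ne_zero hb' hwb) ((mk_mem_transversalLines_iff hF hb hb' hwb).1 hbT)⟩

lemma continuous_projectivization_mk :
    Continuous fun v : {v : Fin 3 → ℂ // v ≠ 0} => (Projectivization.mk ℂ v.1 v.2 : P2) :=
  continuous_quot_mk

lemma isOpen_transversalLines {F : MvPolynomial (Fin 3) ℂ} {d : ℕ} (hd : 1 ≤ d)
    (hF : F.IsHomogeneous d) : IsOpen (transversalLines F d) := by
  have hcont (w w' : Fin 3 → ℂ) : Continuous fun a => transversalityPoly F d a w w' := by
    have h (a : Fin 3 → ℂ) : transversalityPoly F d a w w' =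
        eval a (transversalityPoly F d X (fun i => C (w i)) (fun i => C (w' i))) := by
      have := transversalityPoly_map (aeval a) F d X (fun i => C (w i)) (fun i => C (w' i))
      simp only [aeval_X, algHom_C, Algebra.algebraMap_self_apply] at this
      exact this.symm
    simp only [h]
    exact continuous_eval _
  refine isOpen_coinduced.2 (isOpen_iff_mem_nhds.2 ?_)
  rintro ⟨a, ha⟩ haT
  obtain ⟨w, w', hw, -⟩ := exists_transversalityPoly_ne_zero hd hF ha ha haT haT
  filter_upwards [((hcont w w').comp continuous_subtype_val).continuousAt.eventually_ne hw]
    with b hb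
  exact mk_mem_transversalLines hF hb b.2

lemma isPathConnected_transversalLines {F : MvPolynomial (Fin 3) ℂ} {d : ℕ} (hd : 1 ≤ d)
    (hF : F.IsHomogeneous d) (hne : (transversalLines F d).Nonempty) :
    IsPathConnected (transversalLines F d) := by
  refine isPathConnected_iff.2 ⟨hne, fun ξ hξ η hη => ?_⟩
  induction ξ using Projectivization.ind with
  | _ a ha =>
  induction η using Projectivization.ind with
  | _ b hb =>
  obtain ⟨w, w', hwa, hwb⟩ := exists_transversalityPoly_ne_zero hd hF ha hb hξ hη
  let Q : Polynomial ℂ := transversalityPoly F d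
    (fun i => Polynomial.C (a i) + Polynomial.X * Polynomial.C (b i - a i))
    (fun i => Polynomial.C (w i)) (fun i => Polynomial.C (w' i))
  have hQ (s : ℂ) : Q.eval s = transversalityPoly F d (a + s • (b - a)) w w' := by
    have := transversalityPoly_map (Polynomial.aeval s) F d
      (fun i => Polynomial.C (a i) + Polynomial.X * Polynomial.C (b i - a i))
      (fun i => Polynomial.C (w i)) (fun i => Polynomial.C (w' i))
    simp only [map_add, map_mul, Polynomial.aeval_C, Polynomial.aeval_X,
      Algebra.algebraMap_self_apply] at this
    exact this
  have hQ0 : Q.eval 0 ≠ 0 := by simpa [hQ] using hwa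
  have hQ1 : Q.eval 1 ≠ 0 := by simpa [hQ] using hwb
  have hQne : Q ≠ 0 := by
    intro h
    simp [h] at hQ0
  have hpc : IsPathConnected {s : ℂ | Q.IsRoot s}ᶜ :=
    (Polynomial.finite_setOfPred_isRoot hQne).countable.isPathConnected_compl_of_one_lt_rank
      (by simp)
  obtain ⟨γ, hγ⟩ := hpc.joinedIn 0 hQ0 1 hQ1
  have hγQ (t : unitInterval) : transversalityPoly F d (a + γ t • (b - a)) w w' ≠ 0 := by
    rw [← hQ]
    exact hγ t
  have hγne (t : unitInterval) := ne_zero_of_transversalityPoly_ne_zero (hγQ t)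
  refine ⟨⟨⟨fun t => Projectivization.mk ℂ _ (hγne t), ?_⟩, ?_, ?_⟩, fun t =>
    mk_mem_transversalLines hF (hγQ t) (hγne t)⟩
  · have : Continuous fun t : unitInterval => a + γ t • (b - a) := by fun_prop
    exact continuous_projectivization_mk.comp (this.subtype_mk hγne)
  · simp
  · simp

end

/-- For a reduced plane curve `C = {F = 0}` of degree `d ≥ 1`, the set
`T_C` of lines meeting `C` transversally is a nonempty, open, and path-connected subset
of the dual projective plane `ℙ̂²`. -/
theorem transversalLines_nonempty_isOpen_isPathConnected (F : MvPolynomial (Fin 3) ℂ)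
    (d : ℕ) (hd : 1 ≤ d) (hF : F.IsHomogeneous d) (hsq : Squarefree F) :
    (transversalLines F d).Nonempty ∧ IsOpen (transversalLines F d) ∧
      IsPathConnected (transversalLines F d) := by
  have hne := transversalLines_nonempty hF hsq
  exact ⟨hne, isOpen_transversalLines hd hF, isPathConnected_transversalLines hd hF hne⟩

end
end

section
/- Let γ : [0,1] → T_C be a continuous path of transversal lines and let ψ : [0,1] → ℙ² be a continuous map with ψ(t) ∈ C ∩ γ(t) for all t. If ψ(0) lies on the irreducible component C_i of C, then ψ(t) ∈ C_i for all t ∈ [0,1]. In particular, if γ is a loop based at l₀ ∈ T_C, then ψ(1) ∈ C_i ∩ l₀; and if moreover C_i is a line (d_i = 1), then ψ(1) = ψ(0). -/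
open MvPolynomial

noncomputable section

namespace MvPolynomial

theorem IsHomogeneous.eval_smul {σ R : Type*} [CommSemiring R] {H : MvPolynomial σ R} {n : ℕ}
    (hH : H.IsHomogeneous n) (c : R) (x : σ → R) : eval (c • x) H = c ^ n * eval x H := by
  rw [eval_eq, eval_eq, Finset.mul_sum]
  refine Finset.sum_congr rfl fun s hs => ?_
  have hdeg : ∑ i ∈ s.support, s i = n := by
    rw [hH.degree_eq_sum_deg_support hs]
  simp only [Pi.smul_apply, smul_eq_mul, mul_pow, Finset.prod_mul_distrib,
    Finset.prod_pow_eq_pow_sum, hdeg]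
  ring

/-- A homogeneous divisor of a nonzero homogeneous polynomial has a homogeneous cofactor. -/
theorem IsHomogeneous.exists_isHomogeneous_mul_of_dvd {σ R : Type*} [CommSemiring R]
    {F P : MvPolynomial σ R} {m n : ℕ} (hF : F.IsHomogeneous n) (hF0 : F ≠ 0)
    (hP : P.IsHomogeneous m) (hdvd : P ∣ F) :
    ∃ G : MvPolynomial σ R, ∃ k, G.IsHomogeneous k ∧ m + k = n ∧ F = P * G := by
  let _ : GradedAlgebra (homogeneousSubmodule σ R) := gradedAlgebra
  obtain ⟨G, rfl⟩ := hdvd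
  have hself := DirectSum.decompose_of_mem_same (homogeneousSubmodule σ R) hF
  by_cases hmn : m ≤ n
  · refine ⟨DirectSum.decompose (homogeneousSubmodule σ R) G (n - m), n - m,
      (DirectSum.decompose (homogeneousSubmodule σ R) G (n - m)).2, Nat.add_sub_cancel' hmn, ?_⟩
    rw [← DirectSum.coe_decompose_mul_of_left_mem_of_le (homogeneousSubmodule σ R) hP hmn, hself]
  · rw [DirectSum.coe_decompose_mul_of_left_mem_of_not_le (homogeneousSubmodule σ R) hP hmn]
      at hself
    exact absurd hself.symm hF0

end MvPolynomial

theorem mk_mem_curveSet_iff_s9 {H : MvPolynomial (Fin 3) ℂ} {n : ℕ} (hH : H.IsHomogeneous n)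
    {v : Fin 3 → ℂ} (hv : v ≠ 0) :
    Projectivization.mk ℂ v hv ∈ curveSet H ↔ eval v H = 0 := by
  obtain ⟨a, ha⟩ := Projectivization.exists_smul_eq_mk_rep ℂ v hv
  rw [curveSet, Set.mem_ofPred_eq, ← ha, Units.smul_def, hH.eval_smul]
  simp

theorem mk_mem_lineSet_iff_s9 {ξ : P2} {v : Fin 3 → ℂ} (hv : v ≠ 0) :
    Projectivization.mk ℂ v hv ∈ lineSet ξ ↔ ∑ i, ξ.rep i * v i = 0 := by
  obtain ⟨a, ha⟩ := Projectivization.exists_smul_eq_mk_rep ℂ v hv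
  have hmul : ∑ i, ξ.rep i * (a • v) i = a * ∑ i, ξ.rep i * v i := by
    rw [Finset.mul_sum]
    exact Finset.sum_congr rfl fun i _ => by simp [Units.smul_def]; ring
  rw [lineSet, Set.mem_ofPred_eq, ← ha, hmul]
  simp

theorem isClosed_curveSet {H : MvPolynomial (Fin 3) ℂ} {n : ℕ} (hH : H.IsHomogeneous n) :
    IsClosed (curveSet H) := by
  have hquot : Topology.IsQuotientMap
      (fun v : {v : Fin 3 → ℂ // v ≠ 0} => (Projectivization.mk ℂ v.1 v.2 : P2)) :=
    isQuotientMap_quotient_mk'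
  rw [← hquot.isClosed_preimage]
  have hpre : (fun v : {v : Fin 3 → ℂ // v ≠ 0} => (Projectivization.mk ℂ v.1 v.2 : P2)) ⁻¹'
      curveSet H =
      {v | eval v.1 H = 0} := by
    ext v
    exact mk_mem_curveSet_iff_s9 hH v.2
  rw [hpre]
  exact isClosed_eq ((MvPolynomial.continuous_eval H).comp continuous_subtype_val)
    continuous_const

/-- A line in the plane is spanned by two linearly independent vectors. -/
theorem exists_basis_of_line (ξ : P2) :
    ∃ u v : Fin 3 → ℂ, LinearIndependent ℂ ![u, v] ∧
      ∀ x : Fin 3 → ℂ, ∑ i, ξ.rep i * x i = 0 ↔ ∃ a b : ℂ, a • u + b • v = x := by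
  let f : (Fin 3 → ℂ) →ₗ[ℂ] ℂ := Fintype.linearCombination ℂ ξ.rep
  have hf : ∀ x, f x = ∑ i, ξ.rep i * x i := fun x => by
    simp [f, Fintype.linearCombination_apply, mul_comm]
  have hf0 : f ≠ 0 := fun h => ξ.rep_nonzero <| funext fun i => by
    simpa [hf, Pi.single_apply] using LinearMap.congr_fun h (Pi.single i 1)
  have hrank : Module.finrank ℂ (LinearMap.ker f) = 2 := by
    have := Module.Dual.finrank_ker_add_one_of_ne_zero hf0
    simp at this
    omega
  let B := Module.finBasisOfFinrankEq ℂ (LinearMap.ker f) hrank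
  refine ⟨B 0, B 1, ?_, fun x => ?_⟩
  · have := B.linearIndependent.map' (LinearMap.ker f).subtype (Submodule.ker_subtype _)
    have hB : ![(B 0 : Fin 3 → ℂ), (B 1 : Fin 3 → ℂ)] = (LinearMap.ker f).subtype ∘ B := by
      ext i j
      fin_cases i <;> rfl
    rwa [hB]
  · rw [← hf, ← LinearMap.mem_ker]
    constructor
    · intro hx
      refine ⟨B.repr ⟨x, hx⟩ 0, B.repr ⟨x, hx⟩ 1, ?_⟩
      have := congrArg Subtype.val (B.sum_repr ⟨x, hx⟩)
      rwa [Fin.sum_univ_two] at this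
    · rintro ⟨a, b, rfl⟩
      exact add_mem (Submodule.smul_mem _ _ (B 0).2) (Submodule.smul_mem _ _ (B 1).2)

theorem add_smul_ne_zero_of_linearIndependent {V : Type*} [AddCommGroup V] [Module ℂ V]
    {u v : V} (h : LinearIndependent ℂ ![u, v]) (t : ℂ) : u + t • v ≠ 0 := fun h0 => by
  have := LinearIndependent.pair_iff.1 h 1 t (by simpa using h0)
  exact one_ne_zero this.1

theorem mk_add_smul_injective {V : Type*} [AddCommGroup V] [Module ℂ V] {u v : V}
    (h : LinearIndependent ℂ ![u, v]) :
    Function.Injective fun t : ℂ => Projectivization.mk ℂ (u + t • v)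
      (add_smul_ne_zero_of_linearIndependent h t) := by
  intro s t hst
  obtain ⟨a, ha⟩ := (Projectivization.mk_eq_mk_iff' ℂ _ _ _ _).1 hst
  have := LinearIndependent.pair_iff.1 h (a - 1) (a * t - s) (by
    rw [← sub_eq_zero.2 ha]; module)
  have ha1 : a = 1 := sub_eq_zero.1 this.1
  have := this.2
  rw [ha1, one_mul, sub_eq_zero] at this
  exact this.symm

/-- If a curve meets a line in finitely many points, it does not contain any affine chart of
that line. -/
theorem exists_eval_add_smul_ne_zero {H : MvPolynomial (Fin 3) ℂ} {n : ℕ}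
    (hH : H.IsHomogeneous n) {ξ : P2} (hfin : (curveSet H ∩ lineSet ξ).Finite)
    {u v : Fin 3 → ℂ} (huv : LinearIndependent ℂ ![u, v])
    (hline : ∀ a b : ℂ, ∑ i, ξ.rep i * (a • u + b • v) i = 0) :
    ∃ t : ℂ, eval (u + t • v) H ≠ 0 := by
  by_contra! hzero
  refine Set.infinite_of_injective_forall_mem (mk_add_smul_injective huv) (fun t => ?_) hfin
  refine ⟨(mk_mem_curveSet_iff_s9 hH _).2 (hzero t), (mk_mem_lineSet_iff_s9 _).2 ?_⟩
  simpa using hline 1 t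

/-- A curve of degree `n` meets a line not contained in it in at most `n` points. -/
theorem ncard_curveSet_inter_lineSet_le {H : MvPolynomial (Fin 3) ℂ} {n : ℕ}
    (hH : H.IsHomogeneous n) {ξ : P2} (hfin : (curveSet H ∩ lineSet ξ).Finite) :
    (curveSet H ∩ lineSet ξ).ncard ≤ n := by
  obtain ⟨u, v, huv, hline⟩ := exists_basis_of_line ξ
  have hvu : LinearIndependent ℂ ![v, u] := LinearIndependent.pair_symm_iff.1 huv
  obtain ⟨s, hs⟩ := exists_eval_add_smul_ne_zero hH hfin hvu
    fun a b => (hline _).2 ⟨b, a, add_comm _ _⟩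
  set w := v + s • u with hw
  have huw : LinearIndependent ℂ ![u, w] := by
    refine LinearIndependent.pair_iff.2 fun a b hab => ?_
    have := LinearIndependent.pair_iff.1 huv (a + b * s) b (by
      rw [← hab, hw]; module)
    obtain ⟨h1, rfl⟩ := this
    simpa using h1
  have hlinew : ∀ x : Fin 3 → ℂ, ∑ i, ξ.rep i * x i = 0 ↔ ∃ a b : ℂ, a • u + b • w = x := by
    intro x
    rw [hline]
    constructor
    · rintro ⟨a, b, rfl⟩
      exact ⟨a - b * s, b, by rw [hw]; module⟩
    · rintro ⟨a, b, rfl⟩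
      exact ⟨a + b * s, b, by rw [hw]; module⟩
  let g : Fin 3 → Polynomial ℂ := fun i => Polynomial.C (u i) + Polynomial.C (w i) * Polynomial.X
  let p : Polynomial ℂ := aeval g H
  have hp : ∀ t, p.eval t = eval (u + t • w) H := fun t => by
    have hcomp : (Polynomial.evalRingHom t).comp (algebraMap ℂ (Polynomial ℂ)) = RingHom.id ℂ := by
      ext; simp
    have hg : (fun i => Polynomial.evalRingHom t (g i)) = u + t • w := by
      ext i
      simp only [g, Polynomial.coe_evalRingHom, Polynomial.eval_add, Polynomial.eval_mul,
        Polynomial.eval_C, Polynomial.eval_X, Pi.add_apply, Pi.smul_apply, smul_eq_mul]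
      ring
    rw [← Polynomial.coe_evalRingHom, map_aeval, hcomp, hg]
    rfl
  have hp0 : p ≠ 0 := fun h => by
    obtain ⟨t, ht⟩ := exists_eval_add_smul_ne_zero hH hfin huw fun a b => (hlinew _).2 ⟨a, b, rfl⟩
    exact ht (by rw [← hp, h, Polynomial.eval_zero])
  have hpdeg : p.natDegree ≤ n := by
    have := aeval_natDegree_le H hH.totalDegree_le g (n := 1) fun i => by
      simp only [g]; compute_degree
    simpa using this
  have hsub : curveSet H ∩ lineSet ξ ⊆ (fun t : ℂ => Projectivization.mk ℂ (u + t • w)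
      (add_smul_ne_zero_of_linearIndependent huw t)) '' (p.roots.toFinset : Set ℂ) := by
    rintro x ⟨hxH, hxl⟩
    obtain ⟨a, b, hab⟩ := (hlinew _).1 hxl
    have ha : a ≠ 0 := by
      rintro rfl
      have hb : b ≠ 0 := by
        rintro rfl
        exact x.rep_nonzero (by simp [← hab])
      have h0 : eval x.rep H = 0 := hxH
      rw [← hab, zero_smul, zero_add, hH.eval_smul] at h0
      exact mul_ne_zero (pow_ne_zero _ hb) hs h0
    have hx : Projectivization.mk ℂ (u + (b / a) • w)
        (add_smul_ne_zero_of_linearIndependent huw (b / a)) = x := by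
      rw [← x.mk_rep, Projectivization.mk_eq_mk_iff']
      refine ⟨a⁻¹, ?_⟩
      rw [← hab, smul_add, smul_smul, smul_smul, inv_mul_cancel₀ ha, one_smul, div_eq_inv_mul]
    refine ⟨b / a, ?_, hx⟩
    rw [← hx, mk_mem_curveSet_iff_s9 hH, ← hp] at hxH
    simpa [hp0] using hxH
  calc (curveSet H ∩ lineSet ξ).ncard
      ≤ _ := Set.ncard_le_ncard hsub ((Finset.finite_toSet _).image _)
    _ ≤ (p.roots.toFinset : Set ℂ).ncard := Set.ncard_image_le (Finset.finite_toSet _)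
    _ = p.roots.toFinset.card := Set.ncard_coe_finset _
    _ ≤ p.natDegree := (Multiset.toFinset_card_le _).trans p.card_roots'
    _ ≤ n := hpdeg

theorem curveSet_mul (P G : MvPolynomial (Fin 3) ℂ) :
    curveSet (P * G) = curveSet P ∪ curveSet G := by
  ext x
  simp [curveSet]

theorem finite_inter_lineSet_of_mem_transversalLines {F : MvPolynomial (Fin 3) ℂ} {d : ℕ}
    (hd : 1 ≤ d) {ξ : P2} (hξ : ξ ∈ transversalLines F d) :
    (curveSet F ∩ lineSet ξ).Finite :=
  Set.finite_of_ncard_pos (hd.trans_eq (Eq.symm hξ))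

/-- On a transversal line, two complementary subcurves have no common point. -/
theorem disjoint_curveSet_of_mem_transversalLines {P G : MvPolynomial (Fin 3) ℂ} {m k : ℕ}
    (hP : P.IsHomogeneous m) (hG : G.IsHomogeneous k) (hmk : 1 ≤ m + k) {ξ : P2}
    (hξ : ξ ∈ transversalLines (P * G) (m + k)) :
    Disjoint (curveSet P ∩ lineSet ξ) (curveSet G ∩ lineSet ξ) := by
  have hfin := finite_inter_lineSet_of_mem_transversalLines hmk hξ
  have hcard : (curveSet (P * G) ∩ lineSet ξ).ncard = m + k := hξ
  rw [curveSet_mul, Set.union_inter_distrib_right] at hfin hcard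
  have hfinP := hfin.subset Set.subset_union_left
  have hfinG := hfin.subset Set.subset_union_right
  have hsum := Set.ncard_union_add_ncard_inter _ _ hfinP hfinG
  have hPle := ncard_curveSet_inter_lineSet_le hP hfinP
  have hGle := ncard_curveSet_inter_lineSet_le hG hfinG
  rw [Set.disjoint_iff_inter_eq_empty, ← Set.ncard_eq_zero (hfinP.inter_of_left _)]
  omega

/-- Let `C = {F = 0}` be a reduced plane curve of degree `d ≥ 1` and
`C_i = {F_i = 0}` an irreducible component of `C` (so `F_i` is an irreducible factor of
`F`), homogeneous of degree `d_i`.  Let `γ : [0,1] → T_C` be a continuous path of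
transversal lines and `ψ : [0,1] → ℙ²` a continuous map with `ψ t ∈ C ∩ γ t` for all
`t`.  If `ψ 0` lies on `C_i`, then `ψ t ∈ C_i` for all `t`.  In particular, if `γ` is a
loop based at `l₀ = γ 0`, then `ψ 1 ∈ C_i ∩ l₀`; and if moreover `C_i` is a line
(`d_i = 1`), then `ψ 1 = ψ 0`. -/
theorem path_stays_on_component (F Fi : MvPolynomial (Fin 3) ℂ) (d di : ℕ)
    (hd : 1 ≤ d) (hF : F.IsHomogeneous d) (hsq : Squarefree F)
    (hirr : Irreducible Fi) (hdvd : Fi ∣ F) (hFi : Fi.IsHomogeneous di)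
    (γ : unitInterval → P2) (hγ : Continuous γ)
    (hγT : ∀ t, γ t ∈ transversalLines F d)
    (ψ : unitInterval → P2) (hψ : Continuous ψ)
    (hψmem : ∀ t, ψ t ∈ curveSet F ∩ lineSet (γ t))
    (h0 : ψ 0 ∈ curveSet Fi) :
    (∀ t, ψ t ∈ curveSet Fi) ∧
    (γ 1 = γ 0 → ψ 1 ∈ curveSet Fi ∩ lineSet (γ 0)) ∧
    (γ 1 = γ 0 → di = 1 → ψ 1 = ψ 0) := by
  obtain ⟨G, k, hG, rfl, rfl⟩ := hF.exists_isHomogeneous_mul_of_dvd hsq.ne_zero hFi hdvd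
  have hcompl : ψ ⁻¹' curveSet Fi = (ψ ⁻¹' curveSet G)ᶜ := by
    ext t
    have hdisj := Set.disjoint_left.1
      (disjoint_curveSet_of_mem_transversalLines hFi hG hd (hγT t))
    obtain ⟨hC, hl⟩ := hψmem t
    rw [curveSet_mul] at hC
    exact ⟨fun hP hQ => hdisj ⟨hP, hl⟩ ⟨hQ, hl⟩, fun hQ => hC.resolve_right hQ⟩
  have hclopen : IsClopen (ψ ⁻¹' curveSet Fi) :=
    ⟨(isClosed_curveSet hFi).preimage hψ,
      hcompl ▸ ((isClosed_curveSet hG).preimage hψ).isOpen_compl⟩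
  have hall : ∀ t, ψ t ∈ curveSet Fi :=
    Set.eq_univ_iff_forall.1 (hclopen.eq_univ ⟨0, h0⟩)
  have hend : γ 1 = γ 0 → ψ 1 ∈ curveSet Fi ∩ lineSet (γ 0) :=
    fun h => ⟨hall 1, h ▸ (hψmem 1).2⟩
  refine ⟨hall, hend, fun h hdi => ?_⟩
  have hfin : (curveSet Fi ∩ lineSet (γ 0)).Finite :=
    (finite_inter_lineSet_of_mem_transversalLines hd (hγT 0)).subset
      (Set.inter_subset_inter_left _ (curveSet_mul Fi G ▸ Set.subset_union_left))
  exact (Set.ncard_le_one hfin).1 (hdi ▸ ncard_curveSet_inter_lineSet_le hFi hfin)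
    _ (hend h) _ ⟨h0, (hψmem 0).2⟩

end
end
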